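/- Fix x₀, a unit vector ν ∈ ∂B₁, and let u_{x₀}(x) = ϑ(x₀)(x·ν)₊^{β(x₀)}. Then the Weiss energy of u_{x₀} at the origin, computed with parameters frozen at x₀, is constant in r: A_{u_{x₀},0}(r) = V(x₀) for all r > 0, where V(x₀) depends only on the values γ(x₀), δ(x₀) and on the dimension d (in particular it is independent of ν). Moreover, x₀ ↦ V(x₀) is continuous, with modulus of continuity depending only on those of γ and δ. -/

import Mathlib

open MeasureTheory Metric Set Filter Topology RealInnerProductSpace

noncomputable section

namespace AltPhillips

/-- A modulus of continuity: nonnegative, nondecreasing on `[0,∞)`, vanishing at `0⁺`. -/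
def IsModulus (ω : ℝ → ℝ) : Prop :=
  (∀ t, 0 ≤ ω t) ∧ MonotoneOn ω (Set.Ici 0) ∧
    Filter.Tendsto ω (nhdsWithin 0 (Set.Ioi 0)) (nhds 0)

/-- Dini condition on `(0,2)`: `∫₀² F(t)/t dt < ∞`. -/
def Dini (F : ℝ → ℝ) : Prop := IntegrableOn (fun t => F t / t) (Set.Ioo (0:ℝ) 2)

/-- The homogeneity exponent `β = 2/(2-γ)`. -/
def beta (g : ℝ) : ℝ := 2 / (2 - g)

/-- The constant `ϑ = ((β-1)β/(γδ))^{1/(γ-2)}` of the trivial cone. -/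
def theta (g δ0 : ℝ) : ℝ := ((beta g - 1) * beta g / (g * δ0)) ^ (1 / (g - 2))

variable {d : ℕ}

/-- Variable-coefficient Alt–Phillips energy with matrix `A`. -/
def JA (A : EuclideanSpace ℝ (Fin d) → (EuclideanSpace ℝ (Fin d) →L[ℝ] EuclideanSpace ℝ (Fin d)))
    (δ γ w : EuclideanSpace ℝ (Fin d) → ℝ) (O : Set (EuclideanSpace ℝ (Fin d))) : ℝ :=
  ∫ x in O, ((1/2) * ⟪A x (gradient w x), gradient w x⟫ + δ x * (w x) ^ (γ x))

/-- Alt–Phillips energy with `A = Id`. -/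
def Jl (δ γ w : EuclideanSpace ℝ (Fin d) → ℝ) (O : Set (EuclideanSpace ℝ (Fin d))) : ℝ :=
  ∫ x in O, ((1/2) * ‖gradient w x‖ ^ 2 + δ x * (w x) ^ (γ x))

/-- `A` is symmetric and uniformly `Λ`-elliptic on `Ω`. -/
def Elliptic (Λ : ℝ)
    (A : EuclideanSpace ℝ (Fin d) → (EuclideanSpace ℝ (Fin d) →L[ℝ] EuclideanSpace ℝ (Fin d)))
    (Ω : Set (EuclideanSpace ℝ (Fin d))) : Prop :=
  ∀ x ∈ Ω, (∀ ξ η, ⟪A x ξ, η⟫ = ⟪ξ, A x η⟫) ∧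
    ∀ ξ : EuclideanSpace ℝ (Fin d), ‖ξ‖ = 1 → ⟪A x ξ, ξ⟫ ∈ Set.Icc Λ Λ⁻¹

/-- `u ≥ 0` is an almost minimizer with gauge `ϱ` of the Alt–Phillips energy in `Ω`:
competitors are functions agreeing with `u` outside the ball. -/
def AlmostMinA (ϱ : ℝ → ℝ)
    (A : EuclideanSpace ℝ (Fin d) → (EuclideanSpace ℝ (Fin d) →L[ℝ] EuclideanSpace ℝ (Fin d)))
    (δ γ : EuclideanSpace ℝ (Fin d) → ℝ) (Ω : Set (EuclideanSpace ℝ (Fin d)))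
    (u : EuclideanSpace ℝ (Fin d) → ℝ) : Prop :=
  (∀ x, 0 ≤ u x) ∧
  ∀ x₀ r, 0 < r → ball x₀ r ⊆ Ω →
    ∀ v : EuclideanSpace ℝ (Fin d) → ℝ, (∀ x, x ∉ ball x₀ r → v x = u x) →
      JA A δ γ u (ball x₀ r) ≤ (1 + ϱ r) * JA A δ γ v (ball x₀ r)

/-- `u ≥ 0` is a local minimizer of the variable-coefficient Alt–Phillips energy in `Ω`. -/
def LocalMinA
    (A : EuclideanSpace ℝ (Fin d) → (EuclideanSpace ℝ (Fin d) →L[ℝ] EuclideanSpace ℝ (Fin d)))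
    (δ γ : EuclideanSpace ℝ (Fin d) → ℝ) (Ω : Set (EuclideanSpace ℝ (Fin d)))
    (u : EuclideanSpace ℝ (Fin d) → ℝ) : Prop :=
  (∀ x, 0 ≤ u x) ∧
  ∀ x₀ r, 0 < r → ball x₀ r ⊆ Ω →
    ∀ v : EuclideanSpace ℝ (Fin d) → ℝ, (∀ x, x ∉ ball x₀ r → v x = u x) →
      JA A δ γ u (ball x₀ r) ≤ JA A δ γ v (ball x₀ r)

/-- Almost minimizer (gauge `ϱ`) for the energy with `A = Id`. -/
def AlmostMinl (ϱ : ℝ → ℝ) (δ γ : EuclideanSpace ℝ (Fin d) → ℝ)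
    (Ω : Set (EuclideanSpace ℝ (Fin d))) (u : EuclideanSpace ℝ (Fin d) → ℝ) : Prop :=
  (∀ x, 0 ≤ u x) ∧
  ∀ x₀ r, 0 < r → ball x₀ r ⊆ Ω →
    ∀ v : EuclideanSpace ℝ (Fin d) → ℝ, (∀ x, x ∉ ball x₀ r → v x = u x) →
      Jl δ γ u (ball x₀ r) ≤ (1 + ϱ r) * Jl δ γ v (ball x₀ r)

/-- Local minimizer for the energy with `A = Id`. -/
def LocalMinl (δ γ : EuclideanSpace ℝ (Fin d) → ℝ)
    (Ω : Set (EuclideanSpace ℝ (Fin d))) (u : EuclideanSpace ℝ (Fin d) → ℝ) : Prop :=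
  (∀ x, 0 ≤ u x) ∧
  ∀ x₀ r, 0 < r → ball x₀ r ⊆ Ω →
    ∀ v : EuclideanSpace ℝ (Fin d) → ℝ, (∀ x, x ∉ ball x₀ r → v x = u x) →
      Jl δ γ u (ball x₀ r) ≤ Jl δ γ v (ball x₀ r)

/-- The free boundary `F(u) = ∂{u>0} ∩ Ω`. -/
def FB (Ω : Set (EuclideanSpace ℝ (Fin d))) (u : EuclideanSpace ℝ (Fin d) → ℝ) :
    Set (EuclideanSpace ℝ (Fin d)) :=
  frontier {x | 0 < u x} ∩ Ω

/-- The growth condition at free boundary points: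
`sup_{B_r(x₀)} (u + |∇u|^{2/γ(x₀)}) ≤ C r^{β(x₀)}`. -/
def Growth (Ω : Set (EuclideanSpace ℝ (Fin d))) (γ u : EuclideanSpace ℝ (Fin d) → ℝ) : Prop :=
  ∃ C > (0:ℝ), ∀ x₀ ∈ FB Ω u, ∀ r : ℝ, 0 < r → ball x₀ r ⊆ Ω → ∀ x ∈ ball x₀ r,
    u x + ‖gradient u x‖ ^ (2 / γ x₀) ≤ C * r ^ (beta (γ x₀))

/-- The Weiss energy centered at `x₀` with frozen parameters `δ0, γ0` (and `A(x₀) = Id`). -/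
def Weiss (δ0 γ0 : ℝ) (u : EuclideanSpace ℝ (Fin d) → ℝ) (x₀ : EuclideanSpace ℝ (Fin d))
    (r : ℝ) : ℝ :=
  r ^ (-((d:ℝ) + 2 * (beta γ0 - 1))) *
      (∫ x in ball x₀ r, ((1/2) * ‖gradient u x‖ ^ 2 + δ0 * (u x) ^ γ0))
    - (1/2) * beta γ0 * r ^ (-((d:ℝ) + 2 * beta γ0 - 1)) *
      ∫ y in sphere x₀ r, (u y) ^ 2 ∂μH[(d:ℝ) - 1]

/-- Blow-up limit of `u` at `x₀`, with homogeneity exponent `β(γ0)`. -/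
def BlowUpC (γ0 : ℝ) (u : EuclideanSpace ℝ (Fin d) → ℝ) (x₀ : EuclideanSpace ℝ (Fin d))
    (u₀ : EuclideanSpace ℝ (Fin d) → ℝ) : Prop :=
  ∃ rk : ℕ → ℝ, (∀ k, 0 < rk k) ∧ Filter.Tendsto rk Filter.atTop (nhds 0) ∧
    TendstoLocallyUniformly (fun k x => (rk k) ^ (-(beta γ0)) * u (x₀ + rk k • x)) u₀
      Filter.atTop

/-- The trivial cone with parameters `δ0, γ0` in direction `ν`. -/
def TrivialCone (δ0 γ0 : ℝ) (ν : EuclideanSpace ℝ (Fin d)) : EuclideanSpace ℝ (Fin d) → ℝ :=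
  fun x => theta γ0 δ0 * (max ⟪x, ν⟫ 0) ^ (beta γ0)

/-- Regular points of the free boundary: some blow-up is a trivial cone. -/
def Reg (δ γ : EuclideanSpace ℝ (Fin d) → ℝ) (Ω : Set (EuclideanSpace ℝ (Fin d)))
    (u : EuclideanSpace ℝ (Fin d) → ℝ) : Set (EuclideanSpace ℝ (Fin d)) :=
  {x₀ | x₀ ∈ FB Ω u ∧ ∃ u₀, BlowUpC (γ x₀) u x₀ u₀ ∧
    ∃ ν : EuclideanSpace ℝ (Fin d), ‖ν‖ = 1 ∧ u₀ = TrivialCone (δ x₀) (γ x₀) ν}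

/-- Singular points: `Σ(u) = F(u) \ R(u)`. -/
def Sing (δ γ : EuclideanSpace ℝ (Fin d) → ℝ) (Ω : Set (EuclideanSpace ℝ (Fin d)))
    (u : EuclideanSpace ℝ (Fin d) → ℝ) : Set (EuclideanSpace ℝ (Fin d)) :=
  FB Ω u \ Reg δ γ Ω u

/-- `δ` is Dini continuous on `Ω`. -/
def DiniContOn (δ : EuclideanSpace ℝ (Fin d) → ℝ) (Ω : Set (EuclideanSpace ℝ (Fin d))) : Prop :=
  ∃ ω : ℝ → ℝ, IsModulus ω ∧ (∀ x ∈ Ω, ∀ y ∈ Ω, |δ x - δ y| ≤ ω (dist x y)) ∧ Dini ω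

/-- `γ` is log-Dini continuous on `Ω`: `t ↦ |ln t|·ω_γ(t)` is Dini. -/
def LogDiniContOn (γ : EuclideanSpace ℝ (Fin d) → ℝ) (Ω : Set (EuclideanSpace ℝ (Fin d))) :
    Prop :=
  ∃ ω : ℝ → ℝ, IsModulus ω ∧ (∀ x ∈ Ω, ∀ y ∈ Ω, |γ x - γ y| ≤ ω (dist x y)) ∧
    Dini (fun t => |Real.log t| * ω t)

end AltPhillips

open AltPhillips

section TrivialConeWeiss

variable {d : ℕ}

local notation "E" => EuclideanSpace ℝ (Fin d)

/-- Integral of the half-space power `(x·ν)₊ ^ a` over the set `s`. -/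
def halfSpaceMoment (μ : Measure E) (s : Set E) (ν : E) (a : ℝ) : ℝ :=
  ∫ x in s, (max ⟪x, ν⟫ 0) ^ a ∂μ

lemma hasDerivAt_max_zero_rpow {p : ℝ} (hp : 1 < p) (t : ℝ) :
    HasDerivAt (fun s : ℝ => (max s 0) ^ p) (p * (max t 0) ^ (p - 1)) t := by
  rcases lt_trichotomy t 0 with h | h | h
  · have h1 : (fun s : ℝ => (max s 0) ^ p) =ᶠ[𝓝 t] fun _ => 0 := by
      filter_upwards [Iio_mem_nhds h] with s hs
      rw [max_eq_right (le_of_lt hs), Real.zero_rpow (by linarith)]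
    rw [max_eq_right h.le, Real.zero_rpow (by linarith), mul_zero]
    exact (hasDerivAt_const t (0 : ℝ)).congr_of_eventuallyEq h1
  · subst h
    rw [max_self, Real.zero_rpow (by linarith), mul_zero, ← hasDerivWithinAt_univ,
      ← Set.Iic_union_Ici (a := (0 : ℝ))]
    refine HasDerivWithinAt.union ?_ ?_
    · refine (hasDerivWithinAt_const (0 : ℝ) _ (0 : ℝ)).congr ?_ ?_
      · intro s hs
        rw [max_eq_right hs, Real.zero_rpow (by linarith)]
      · rw [max_self, Real.zero_rpow (by linarith)]
    · have := (Real.hasDerivAt_rpow_const (x := 0) (p := p) (Or.inr hp.le)).hasDerivWithinAt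
        (s := Set.Ici 0)
      rw [Real.zero_rpow (by linarith), mul_zero] at this
      exact this.congr (fun s hs => by rw [max_eq_left hs]) (by rw [max_self])
  · have h1 : (fun s : ℝ => (max s 0) ^ p) =ᶠ[𝓝 t] fun s => s ^ p := by
      filter_upwards [Ioi_mem_nhds h] with s hs
      rw [max_eq_left (le_of_lt hs)]
    rw [max_eq_left h.le]
    exact (Real.hasDerivAt_rpow_const (Or.inr hp.le)).congr_of_eventuallyEq h1

lemma gradient_trivialCone {g : ℝ} (hg : 1 < beta g) (δ0 : ℝ) (ν x : E) :
    gradient (TrivialCone δ0 g ν) x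
      = (theta g δ0 * (beta g * (max ⟪x, ν⟫ 0) ^ (beta g - 1))) • ν := by
  refine HasGradientAt.gradient ?_
  rw [hasGradientAt_iff_hasFDerivAt]
  have h1 : HasFDerivAt (fun y : E => ⟪y, ν⟫) (InnerProductSpace.toDual ℝ E ν) x := by
    have := (InnerProductSpace.toDual ℝ E ν).hasFDerivAt (x := x)
    refine this.congr_of_eventuallyEq (Eventually.of_forall fun y => ?_)
    simp [real_inner_comm]
  have h2 := ((hasDerivAt_max_zero_rpow hg ⟪x, ν⟫).comp_hasFDerivAt x h1).const_mul (theta g δ0)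
  rw [map_smul, mul_smul]
  exact h2

lemma exists_linearIsometryEquiv_eq {ν e : E} (h : ‖ν‖ = ‖e‖) : ∃ R : E ≃ₗᵢ[ℝ] E, R ν = e :=
  ⟨_, Submodule.reflection_sub h⟩

lemma halfSpaceMoment_eq_of_measurePreserving {μ : Measure E} {s : Set E} (R : E ≃ₗᵢ[ℝ] E)
    (hR : MeasurePreserving R μ μ) (hs : R ⁻¹' s = s) (ν : E) (a : ℝ) :
    halfSpaceMoment μ s (R ν) a = halfSpaceMoment μ s ν a := by
  unfold halfSpaceMoment
  rw [← hR.setIntegral_preimage_emb R.toHomeomorph.measurableEmbedding, hs]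
  simp

lemma halfSpaceMoment_ball_eq {ν e : E} (h : ‖ν‖ = ‖e‖) (a : ℝ) :
    halfSpaceMoment volume (ball 0 1) ν a = halfSpaceMoment volume (ball 0 1) e a := by
  obtain ⟨R, rfl⟩ := exists_linearIsometryEquiv_eq h
  exact (halfSpaceMoment_eq_of_measurePreserving R R.measurePreserving (by ext; simp) ν a).symm

lemma halfSpaceMoment_sphere_eq (k : ℝ) {ν e : E} (h : ‖ν‖ = ‖e‖) (a : ℝ) :
    halfSpaceMoment μH[k] (sphere 0 1) ν a = halfSpaceMoment μH[k] (sphere 0 1) e a := by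
  obtain ⟨R, rfl⟩ := exists_linearIsometryEquiv_eq h
  exact (halfSpaceMoment_eq_of_measurePreserving R
    (R.toIsometryEquiv.measurePreserving_hausdorffMeasure k) (by ext; simp) ν a).symm

lemma max_inner_smul_rpow {r : ℝ} (hr : 0 < r) (x ν : E) (a : ℝ) :
    (max ⟪r • x, ν⟫ 0) ^ a = r ^ a * (max ⟪x, ν⟫ 0) ^ a := by
  rw [real_inner_smul_left, ← Real.mul_rpow hr.le (le_max_right _ _), mul_max_of_nonneg _ _ hr.le,
    mul_zero]

lemma halfSpaceMoment_ball_radius {r : ℝ} (hr : 0 < r) (ν : E) (a : ℝ) :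
    halfSpaceMoment volume (ball 0 r) ν a
      = r ^ ((d : ℝ) + a) * halfSpaceMoment volume (ball 0 1) ν a := by
  have h := Measure.setIntegral_comp_smul_of_pos (volume : Measure E)
    (fun x => (max ⟪x, ν⟫ 0) ^ a) (ball 0 1) hr
  simp only [max_inner_smul_rpow hr, integral_const_mul, smul_unitBall_of_pos hr,
    finrank_euclideanSpace, Fintype.card_fin, smul_eq_mul] at h
  unfold halfSpaceMoment
  rw [Real.rpow_add hr, Real.rpow_natCast, mul_assoc, h, ← mul_assoc,
    mul_inv_cancel₀ (pow_pos hr d).ne', one_mul]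

lemma map_smul_hausdorffMeasure {k : ℝ} (hk : 0 ≤ k) {r : ℝ} (hr : 0 < r) :
    Measure.map (fun x : E => r • x) μH[k] = ENNReal.ofReal (r ^ (-k)) • (μH[k] : Measure E) := by
  ext s hs
  rw [Measure.map_apply (measurable_const_smul r) hs, Set.preimage_smul₀ hr.ne',
    Measure.hausdorffMeasure_smul₀ hk (inv_ne_zero hr.ne'), Measure.smul_apply, smul_eq_mul,
    ENNReal.smul_def, smul_eq_mul]
  congr 1
  rw [ENNReal.ofReal, Real.rpow_neg hr.le, ← Real.inv_rpow hr.le]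
  congr 1
  ext
  rw [NNReal.coe_rpow, coe_nnnorm, Real.norm_of_nonneg (inv_nonneg.2 hr.le),
    Real.coe_toNNReal _ (by positivity)]

lemma halfSpaceMoment_sphere_radius {k : ℝ} (hk : 0 ≤ k) {r : ℝ} (hr : 0 < r) (ν : E) (a : ℝ) :
    halfSpaceMoment μH[k] (sphere 0 r) ν a
      = r ^ (k + a) * halfSpaceMoment μH[k] (sphere 0 1) ν a := by
  have h := (Homeomorph.smulOfNeZero r hr.ne').measurableEmbedding.setIntegral_map
    (μ := (μH[k] : Measure E)) (fun x => (max ⟪x, ν⟫ 0) ^ a) (sphere 0 r)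
  have hpre : (fun x : E => r • x) ⁻¹' sphere 0 r = sphere 0 1 := by
    ext x
    simp [norm_smul, abs_of_pos hr, hr.ne']
  change ∫ y in sphere 0 r, _ ∂(Measure.map (fun x : E => r • x) μH[k])
    = ∫ x in (fun x : E => r • x) ⁻¹' sphere 0 r, (max ⟪r • x, ν⟫ 0) ^ a ∂μH[k] at h
  rw [hpre, map_smul_hausdorffMeasure hk hr, Measure.restrict_smul, integral_smul_measure,
    ENNReal.toReal_ofReal (by positivity), smul_eq_mul] at h
  simp only [max_inner_smul_rpow hr, integral_const_mul] at h
  unfold halfSpaceMoment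
  rw [Real.rpow_add hr, mul_assoc, ← h, ← mul_assoc, ← Real.rpow_add hr, add_neg_cancel,
    Real.rpow_zero, one_mul]

lemma max_inner_rpow_le_one {x ν : E} (hx : ‖x‖ ≤ 1) (hν : ‖ν‖ = 1) {a : ℝ} (ha : 0 < a) :
    ‖(max ⟪x, ν⟫ 0) ^ a‖ ≤ 1 := by
  have h0 : 0 ≤ max ⟪x, ν⟫ 0 := le_max_right _ _
  rw [Real.norm_of_nonneg (Real.rpow_nonneg h0 a)]
  refine Real.rpow_le_one h0 (max_le ?_ zero_le_one) ha.le
  have := real_inner_le_norm x ν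
  rw [hν, mul_one] at this
  exact this.trans hx

lemma measurable_max_inner_rpow (ν : E) (a : ℝ) :
    Measurable fun x : E => (max ⟪x, ν⟫ 0) ^ a :=
  ((Measurable.inner_const measurable_id).max measurable_const).pow_const a

lemma continuousOn_halfSpaceMoment {μ : Measure E} {s : Set E} (hs : MeasurableSet s)
    (hμ : μ s < ⊤) (hs1 : ∀ x ∈ s, ‖x‖ ≤ 1) {ν : E} (hν : ‖ν‖ = 1) :
    ContinuousOn (halfSpaceMoment μ s ν) (Set.Ioi 0) := by
  refine continuousOn_of_dominated (bound := fun _ => 1)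
    (fun a _ => (measurable_max_inner_rpow ν a).aestronglyMeasurable) ?_ ?_ ?_
  · intro a ha
    filter_upwards [ae_restrict_mem hs] with x hx
    exact max_inner_rpow_le_one (hs1 x hx) hν ha
  · exact integrableOn_const hμ.ne
  · exact Eventually.of_forall fun x a ha =>
      (Real.continuousAt_const_rpow' (ne_of_gt ha)).continuousWithinAt

lemma hausdorffMeasure_sphere_lt_top_of_integrableOn {k : ℝ} {e : E} (he : ‖e‖ = 1) {a : ℝ}
    (ha : 0 < a)
    (h : IntegrableOn (fun x : E => (max ⟪x, e⟫ 0) ^ a) (sphere 0 1) μH[k]) :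
    (μH[k] : Measure E) (sphere 0 1) < ⊤ := by
  have hcap : (μH[k] : Measure E) ({x | 1 / 2 ≤ ⟪x, e⟫} ∩ sphere 0 1) < ⊤ := by
    have h1 := Integrable.measure_norm_ge_lt_top h (ε := (1 / 2) ^ a) (by positivity)
    refine lt_of_le_of_lt ?_ h1
    refine le_trans (Measure.le_restrict_apply _ _) (measure_mono fun x hx => ?_)
    have hx' : (1 / 2 : ℝ) ≤ max ⟪x, e⟫ 0 := le_max_of_le_left hx
    change (1 / 2 : ℝ) ^ a ≤ ‖(max ⟪x, e⟫ 0) ^ a‖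
    rw [Real.norm_of_nonneg (Real.rpow_nonneg (le_max_right _ _) a)]
    exact Real.rpow_le_rpow (by norm_num) hx' ha.le
  refine (isCompact_sphere (0 : E) 1).measure_lt_top_of_nhdsWithin fun x hx => ?_
  have hx1 : ‖x‖ = 1 := by simpa using hx
  obtain ⟨R, hR⟩ := exists_linearIsometryEquiv_eq (hx1.trans he.symm)
  refine ⟨R ⁻¹' ({x | 1 / 2 ≤ ⟪x, e⟫} ∩ sphere 0 1), ?_, ?_⟩
  · have hpre : R ⁻¹' ({x | 1 / 2 ≤ ⟪x, e⟫} ∩ sphere 0 1)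
        = {y | 1 / 2 ≤ ⟪y, x⟫} ∩ sphere 0 1 := by
      ext y
      simp [← hR]
    rw [hpre]
    refine inter_mem (mem_nhdsWithin_of_mem_nhds ?_) self_mem_nhdsWithin
    have hc : Continuous fun y : E => ⟪y, x⟫ := by fun_prop
    refine mem_of_superset ((isOpen_lt continuous_const hc).mem_nhds
      (show (1 / 2 : ℝ) < ⟪x, x⟫ by rw [real_inner_self_eq_norm_sq, hx1]; norm_num)) ?_
    intro y hy
    exact le_of_lt (show (1 / 2 : ℝ) < ⟪y, x⟫ from hy)
  · rw [show (R ⁻¹' _ : Set E) = R.toIsometryEquiv ⁻¹' _ from rfl,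
      IsometryEquiv.hausdorffMeasure_preimage]
    exact hcap

lemma continuousOn_halfSpaceMoment_sphere (k : ℝ) {e : E} (he : ‖e‖ = 1) :
    ContinuousOn (halfSpaceMoment μH[k] (sphere 0 1) e) (Set.Ioi 0) := by
  by_cases hfin : (μH[k] : Measure E) (sphere 0 1) < ⊤
  · exact continuousOn_halfSpaceMoment isClosed_sphere.measurableSet hfin
      (fun x hx => (mem_sphere_zero_iff_norm.1 hx).le) he
  · refine (continuousOn_const (c := (0 : ℝ))).congr fun a ha => ?_
    exact integral_undef fun h =>
      hfin (hausdorffMeasure_sphere_lt_top_of_integrableOn he ha h)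

lemma one_lt_beta {g : ℝ} (hg : g ∈ Set.Ioo (0 : ℝ) 1) : 1 < beta g := by
  have := hg.1
  have := hg.2
  rw [beta, lt_div_iff₀ (by linarith)]
  linarith

lemma beta_mul_self {g : ℝ} (hg : g ∈ Set.Ioo (0 : ℝ) 1) : beta g * g = 2 * beta g - 2 := by
  have h : 2 - g ≠ 0 := by linarith [hg.2]
  rw [beta]
  field_simp
  ring

lemma theta_base_pos {g δ0 : ℝ} (hg : g ∈ Set.Ioo (0 : ℝ) 1) (hδ : 0 < δ0) :
    0 < (beta g - 1) * beta g / (g * δ0) := by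
  have h1 := one_lt_beta hg
  exact div_pos (mul_pos (by linarith) (by linarith)) (mul_pos hg.1 hδ)

lemma theta_pos {g δ0 : ℝ} (hg : g ∈ Set.Ioo (0 : ℝ) 1) (hδ : 0 < δ0) : 0 < theta g δ0 :=
  Real.rpow_pos_of_pos (theta_base_pos hg hδ) _

/-- Coefficient of `(x·ν)₊ ^ (2β - 2)` in the energy density of the trivial cone. -/
def coneDensity (g δ0 : ℝ) : ℝ :=
  1 / 2 * (theta g δ0 * beta g) ^ 2 + δ0 * theta g δ0 ^ g

lemma energyDensity_trivialCone {g δ0 : ℝ} (hg : g ∈ Set.Ioo (0 : ℝ) 1) (hδ : 0 < δ0) {ν : E}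
    (hν : ‖ν‖ = 1) (x : E) :
    (1 / 2) * ‖gradient (TrivialCone δ0 g ν) x‖ ^ 2 + δ0 * (TrivialCone δ0 g ν x) ^ g
      = coneDensity g δ0 * (max ⟪x, ν⟫ 0) ^ (2 * beta g - 2) := by
  have hm : 0 ≤ max ⟪x, ν⟫ 0 := le_max_right _ _
  have hsq : ((max ⟪x, ν⟫ 0) ^ (beta g - 1)) ^ 2 = (max ⟪x, ν⟫ 0) ^ (2 * beta g - 2) := by
    rw [← Real.rpow_mul_natCast hm]
    congr 1
    push_cast
    ring
  rw [gradient_trivialCone (one_lt_beta hg), norm_smul, hν, mul_one, Real.norm_eq_abs, sq_abs,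
    TrivialCone, Real.mul_rpow (theta_pos hg hδ).le (Real.rpow_nonneg hm _), ← Real.rpow_mul hm,
    beta_mul_self hg, ← hsq, coneDensity]
  ring

lemma sq_trivialCone (g δ0 : ℝ) (ν x : E) :
    (TrivialCone δ0 g ν x) ^ 2 = theta g δ0 ^ 2 * (max ⟪x, ν⟫ 0) ^ (2 * beta g) := by
  rw [TrivialCone, mul_pow, ← Real.rpow_mul_natCast (le_max_right _ _), mul_comm (beta g)]
  norm_num

/-- The Weiss energy of the trivial cone with direction `e`, at radius one. -/
def coneWeiss (e : E) (g δ0 : ℝ) : ℝ :=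
  coneDensity g δ0 * halfSpaceMoment volume (ball 0 1) e (2 * beta g - 2)
    - 1 / 2 * beta g * theta g δ0 ^ 2
      * halfSpaceMoment μH[(d : ℝ) - 1] (sphere 0 1) e (2 * beta g)

lemma weiss_trivialCone_eq {g δ0 : ℝ} (hg : g ∈ Set.Ioo (0 : ℝ) 1) (hδ : 0 < δ0)
    (hd : 1 ≤ d) {ν : E} (hν : ‖ν‖ = 1) {r : ℝ} (hr : 0 < r) :
    Weiss δ0 g (TrivialCone δ0 g ν) 0 r = coneWeiss ν g δ0 := by
  have hk : (0 : ℝ) ≤ (d : ℝ) - 1 := by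
    have : (1 : ℝ) ≤ d := by exact_mod_cast hd
    linarith
  have hball := halfSpaceMoment_ball_radius hr ν (2 * beta g - 2)
  have hsphere := halfSpaceMoment_sphere_radius hk hr ν (2 * beta g)
  have h1 : r ^ (-((d : ℝ) + 2 * (beta g - 1))) * r ^ ((d : ℝ) + (2 * beta g - 2)) = 1 := by
    rw [← Real.rpow_add hr]
    convert Real.rpow_zero r using 2
    ring
  have h2 : r ^ (-((d : ℝ) + 2 * beta g - 1)) * r ^ ((d : ℝ) - 1 + 2 * beta g) = 1 := by
    rw [← Real.rpow_add hr]
    convert Real.rpow_zero r using 2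
    ring
  rw [Weiss]
  simp only [energyDensity_trivialCone hg hδ hν, sq_trivialCone, integral_const_mul]
  change _ * (_ * halfSpaceMoment volume (ball 0 r) ν _)
    - _ * (_ * halfSpaceMoment μH[(d : ℝ) - 1] (sphere 0 r) ν _) = _
  rw [hball, hsphere, coneWeiss]
  linear_combination
    coneDensity g δ0 * halfSpaceMoment volume (ball 0 1) ν (2 * beta g - 2) * h1
    - 1 / 2 * beta g * theta g δ0 ^ 2
      * halfSpaceMoment μH[(d : ℝ) - 1] (sphere 0 1) ν (2 * beta g) * h2

lemma coneWeiss_eq {ν e : E} (h : ‖ν‖ = ‖e‖) (g δ0 : ℝ) :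
    coneWeiss ν g δ0 = coneWeiss e g δ0 := by
  rw [coneWeiss, coneWeiss, halfSpaceMoment_ball_eq h, halfSpaceMoment_sphere_eq _ h]

lemma continuousOn_coneWeiss {e : E} (he : ‖e‖ = 1) :
    ContinuousOn (fun p : ℝ × ℝ => coneWeiss e p.1 p.2)
      (Set.Ioo (0 : ℝ) 1 ×ˢ Set.Ioi (0 : ℝ)) := by
  set D := Set.Ioo (0 : ℝ) 1 ×ˢ Set.Ioi (0 : ℝ)
  have hfst : ContinuousOn (fun p : ℝ × ℝ => p.1) D := continuousOn_fst
  have hsnd : ContinuousOn (fun p : ℝ × ℝ => p.2) D := continuousOn_snd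
  have hbeta : ContinuousOn (fun p : ℝ × ℝ => beta p.1) D :=
    continuousOn_const.div (continuousOn_const.sub hfst) fun p hp => by linarith [hp.1.2]
  have htheta : ContinuousOn (fun p : ℝ × ℝ => theta p.1 p.2) D := by
    refine ContinuousOn.rpow ?_ ?_ fun p hp => Or.inl (theta_base_pos hp.1 hp.2).ne'
    · exact ((hbeta.sub continuousOn_const).mul hbeta).div (hfst.mul hsnd)
        fun p hp => (mul_pos hp.1.1 hp.2).ne'
    · exact continuousOn_const.div (hfst.sub continuousOn_const) fun p hp => by
        linarith [hp.1.2]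
  have hdensity : ContinuousOn (fun p : ℝ × ℝ => coneDensity p.1 p.2) D :=
    (continuousOn_const.mul ((htheta.mul hbeta).pow 2)).add
      (hsnd.mul (htheta.rpow hfst fun p hp => Or.inl (theta_pos hp.1 hp.2).ne'))
  have hball : ContinuousOn
      (fun p : ℝ × ℝ => halfSpaceMoment volume (ball 0 1) e (2 * beta p.1 - 2)) D :=
    (continuousOn_halfSpaceMoment measurableSet_ball measure_ball_lt_top
      (fun x hx => (mem_ball_zero_iff.1 hx).le) he).comp
      ((continuousOn_const.mul hbeta).sub continuousOn_const) fun p hp => by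
        have := one_lt_beta hp.1
        exact Set.mem_Ioi.2 (by linarith)
  have hsphere : ContinuousOn
      (fun p : ℝ × ℝ => halfSpaceMoment μH[(d : ℝ) - 1] (sphere 0 1) e (2 * beta p.1)) D :=
    (continuousOn_halfSpaceMoment_sphere _ he).comp (continuousOn_const.mul hbeta)
      fun p hp => by
        have := one_lt_beta hp.1
        exact Set.mem_Ioi.2 (by linarith)
  exact (hdensity.mul hball).sub
    (((continuousOn_const.mul hbeta).mul (htheta.pow 2)).mul hsphere)

end TrivialConeWeiss

/-- **Weiss energy of trivial cones** (Lemma 4.2): the Weiss energy of the trivial cone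
`ϑ(x₀)(x·ν)₊^{β(x₀)}`, frozen at `x₀`, is a constant `V` independent of `r` and of `ν`,
depending only on the values `γ(x₀), δ(x₀)` and on the dimension; moreover `V` is a
continuous function of these values. -/
theorem weiss_energy_of_trivial_cone {d : ℕ} :
    ∃ V : ℝ → ℝ → ℝ,
      (∀ γ0 ∈ Set.Ioo (0:ℝ) 1, ∀ δ0 : ℝ, 0 < δ0 →
        ∀ ν : EuclideanSpace ℝ (Fin d), ‖ν‖ = 1 → ∀ r : ℝ, 0 < r →
          Weiss δ0 γ0 (TrivialCone δ0 γ0 ν) (0 : EuclideanSpace ℝ (Fin d)) r = V γ0 δ0) ∧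
      ContinuousOn (fun p : ℝ × ℝ => V p.1 p.2) (Set.Ioo (0:ℝ) 1 ×ˢ Set.Ioi (0:ℝ)) := by
  rcases Nat.eq_zero_or_pos d with rfl | hd
  · refine ⟨fun _ _ => 0, fun γ0 _ δ0 _ ν hν => ?_, continuousOn_const⟩
    rw [Subsingleton.elim ν 0, norm_zero] at hν
    exact absurd hν zero_ne_one
  · have he : ‖EuclideanSpace.single (⟨0, hd⟩ : Fin d) (1 : ℝ)‖ = 1 := by simp
    refine ⟨coneWeiss (EuclideanSpace.single (⟨0, hd⟩ : Fin d) (1 : ℝ)),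
      fun γ0 hγ δ0 hδ ν hν r hr => ?_, continuousOn_coneWeiss he⟩
    rw [weiss_trivialCone_eq hγ hδ hd hν hr, coneWeiss_eq (hν.trans he.symm)]
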